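/- Let G = (V, E) be a finite directed graph and s, t ∈ V. Define the FSA S_G = (V ∪ {v_f}, {a, f, u}, {s}, δ_G, {a}, ℓ) where v_f is a fresh state, δ_G = {(v, a, v'), (v, a, v_f) : (v, v') ∈ E} ∪ {(t, f, v_f), (t, u, v_f), (v_f, a, v_f)}, ℓ(a) = a, ℓ(f) = ℓ(u) = ε, and the faulty event set is T_f = {f}. Then S_G is not T_f-predictable if and only if there is a directed path from s to t in G or s = t. -/

import Mathlib

namespace DES

/-- Run of a labelled transition system along a finite word of events. -/
inductive RunRel {S : Type*} {E : Type*} (δ : S → E → S → Prop) : S → List E → S → Prop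
  | nil (x : S) : RunRel δ x [] x
  | cons {x y z : S} {e : E} {w : List E} :
      δ x e y → RunRel δ y w z → RunRel δ x (e :: w) z

/-- A labelling function (with `none` playing the role of the empty label ε)
extended to words by concatenation (ε's disappear). -/
def obsW {T : Type*} {Λ : Type*} (ℓ : T → Option Λ) (w : List T) : List Λ :=
  w.filterMap ℓ

/-- A finite-state automaton (FSA) `S = (X, T, X₀, δ, Σ, ℓ)`:
states `X`, events `T`, initial states `init`, transition relation `trans`,
labels `Λ`, labelling function `lbl` (with `none` = ε, i.e. unobservable). -/
structure FSA (X : Type*) (T : Type*) (Λ : Type*) where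
  init : Set X
  trans : Set (X × T × X)
  lbl : T → Option Λ

namespace FSA

variable {X : Type*} {T : Type*} {Λ : Type*}

def step (A : FSA X T Λ) (x : X) (t : T) (y : X) : Prop := (x, t, y) ∈ A.trans

/-- extension of the transition relation to words. -/
def Run (A : FSA X T Λ) : X → List T → X → Prop := RunRel A.step

/-- `L(S)`: finite event sequences generated from initial states. -/
def Lang (A : FSA X T Λ) : Set (List T) := {w | ∃ x0 ∈ A.init, ∃ x, A.Run x0 w x}

def InfRun (A : FSA X T Λ) (x : ℕ → X) (s : ℕ → T) : Prop :=
  x 0 ∈ A.init ∧ ∀ n, A.step (x n) (s n) (x (n + 1))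

/-- `L^ω(S)`: infinite event sequences generated from initial states. -/
def LangW (A : FSA X T Λ) : Set (ℕ → T) := {s | ∃ x, A.InfRun x s}

/-- current-state estimate `M_O(S, σ)` under the observation map `O`. -/
def est (A : FSA X T Λ) (O : T → Option Λ) (σ : List Λ) : Set X :=
  {x | ∃ x0 ∈ A.init, ∃ w : List T, obsW O w = σ ∧ A.Run x0 w x}

/-- `y` is reachable from `x` (by a nonempty word). -/
def Reach (A : FSA X T Λ) (x y : X) : Prop := ∃ w : List T, w ≠ [] ∧ A.Run x w y

/-- `y` lies on a transition cycle. -/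
def OnCycle (A : FSA X T Λ) (y : X) : Prop := ∃ w : List T, w ≠ [] ∧ A.Run y w y

/-- the normal sub-automaton: all faulty transitions removed. -/
def normal (A : FSA X T Λ) (Tf : Set T) : FSA X T Λ :=
  ⟨A.init, {tr | tr ∈ A.trans ∧ tr.2.1 ∉ Tf}, A.lbl⟩

/-- local automaton: same data, re-labelled by a local observation map. -/
def localAut (A : FSA X T Λ) (O : T → Option Λ) : FSA X T Λ :=
  ⟨A.init, A.trans, O⟩

end FSA

/-- local observation map of an observer with observable event set `To`:
it sees the global label on events of `To` and nothing otherwise. -/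
noncomputable def localObs {T : Type*} {Λ : Type*} (ℓ : T → Option Λ) (To : Set T) :
    T → Option Λ :=
  fun t => @ite _ (t ∈ To) (Classical.propDecidable _) (ℓ t) none

/-- the first `n` events of an infinite event sequence. -/
def pre {T : Type*} (s : ℕ → T) (n : ℕ) : List T := (List.range n).map s

/-- `s ∈ T*T_f`: the word `s` ends with a faulty event. -/
def endsFaulty {T : Type*} (Tf : Set T) (s : List T) : Prop :=
  ∃ (s₁ : List T) (t : T), t ∈ Tf ∧ s = s₁ ++ [t]

/-- `T_f ∈ s`: the word `s` contains a faulty event. -/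
def hasFault {T : Type*} (Tf : Set T) (s : List T) : Prop := ∃ t ∈ s, t ∈ Tf

namespace FSA

variable {X : Type*} {T : Type*} {Λ : Type*} {L : ℕ}

/-- O-co-detectability (Definition CoDet). -/
def CoDetectable (A : FSA X T Λ) (O : Fin L → T → Option Λ) : Prop :=
  ∃ k : ℕ, ∀ s ∈ A.LangW, ∃ i : Fin L, ∀ n : ℕ,
    k ≤ (obsW (O i) (pre s n)).length →
    (A.est (O i) (obsW (O i) (pre s n))).ncard = 1

/-- strong detectability (Definition StrDet). -/
def StronglyDetectable (A : FSA X T Λ) : Prop :=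
  ∃ k : ℕ, ∀ s ∈ A.LangW, ∀ n : ℕ,
    k ≤ (obsW A.lbl (pre s n)).length →
    (A.est A.lbl (obsW A.lbl (pre s n))).ncard = 1

/-- (O, T_f)-co-diagnosability (Definition CoDiag). -/
def CoDiagnosable (A : FSA X T Λ) (O : Fin L → T → Option Λ) (Tf : Set T) : Prop :=
  ∃ k : ℕ, ∀ s s' : List T, s ∈ A.Lang → endsFaulty Tf s → s ++ s' ∈ A.Lang →
    k ≤ s'.length →
    ∃ i : Fin L, ∀ s'' ∈ A.Lang, obsW (O i) s'' = obsW (O i) (s ++ s') → hasFault Tf s''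

/-- T_f-diagnosability (Definition Diag). -/
def Diagnosable (A : FSA X T Λ) (Tf : Set T) : Prop :=
  ∃ k : ℕ, ∀ s s' : List T, s ∈ A.Lang → endsFaulty Tf s → s ++ s' ∈ A.Lang →
    k ≤ s'.length →
    ∀ s'' ∈ A.Lang, obsW A.lbl s'' = obsW A.lbl (s ++ s') → hasFault Tf s''

/-- (O, T_f)-co-predictability (Definition CoPred). -/
def CoPredictable (A : FSA X T Λ) (O : Fin L → T → Option Λ) (Tf : Set T) : Prop :=
  ∃ k : ℕ, ∀ s ∈ A.Lang, endsFaulty Tf s →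
    ∃ s' : List T, s' <+: s ∧ ¬ hasFault Tf s' ∧
      ∃ i : Fin L, ∀ u v : List T, u ++ v ∈ A.Lang → obsW (O i) s' = obsW (O i) u →
        ¬ hasFault Tf u → k ≤ v.length → hasFault Tf v

/-- T_f-predictability (Definition Pred). -/
def Predictable (A : FSA X T Λ) (Tf : Set T) : Prop :=
  ∃ k : ℕ, ∀ s ∈ A.Lang, endsFaulty Tf s →
    ∃ s' : List T, s' <+: s ∧ ¬ hasFault Tf s' ∧
      ∀ u v : List T, u ++ v ∈ A.Lang → obsW A.lbl s' = obsW A.lbl u →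
        ¬ hasFault Tf u → k ≤ v.length → hasFault Tf v

end FSA

section CC

variable {T : Type*} {Λ : Type*} {L : ℕ}

/-- labelling extended to `Option T` (with `none` = ε). -/
def obsE (ℓ : T → Option Λ) : Option T → Option Λ := fun t? => t?.bind ℓ

/-- one optional step: `none` = stay put, `some t` = take a `t`-transition. -/
def stepOpt {X : Type*} (tr : Set (X × T × X)) : X → Option T → X → Prop :=
  fun x t? y =>
    match t? with
    | none => x = y
    | some t => (x, t, y) ∈ tr

/-- validity of a composite event of the concurrent composition,
restricted to the "active" local components `act`. -/
def ccEventOn (ℓs : Fin L → T → Option Λ) (act : Fin L → Prop)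
    (t0 : Option T) (ts : Fin L → Option T) : Prop :=
  ((∀ j, act j → obsE (ℓs j) t0 = none) ∧
   (∀ j, act j → obsE (ℓs j) (ts j) = none) ∧
   ((t0 ≠ none ∧ ∀ j, act j → ts j = none) ∨
    (t0 = none ∧ ∃ j, act j ∧ ts j ≠ none ∧ ∀ j', act j' → j' ≠ j → ts j' = none)))
  ∨
  ((∃ j, act j ∧ obsE (ℓs j) t0 ≠ none) ∧
   (∀ l, act l →
     (obsE (ℓs l) t0 = none → ts l = none) ∧
     (obsE (ℓs l) t0 ≠ none → obsE (ℓs l) (ts l) = obsE (ℓs l) t0)))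

/-- validity of a composite event of the concurrent composition. -/
def ccEvent (ℓs : Fin L → T → Option Λ) (t0 : Option T) (ts : Fin L → Option T) : Prop :=
  ccEventOn ℓs (fun _ => True) t0 ts

/-- transition relation of the concurrent composition `CC_A(A0; A 0, …, A (L-1))`. -/
def ccTrans {X0 : Type*} {Xs : Fin L → Type*}
    (A0 : FSA X0 T Λ) (A : ∀ i, FSA (Xs i) T Λ) :
    (X0 × (∀ i, Xs i)) → (Option T × (Fin L → Option T)) → (X0 × (∀ i, Xs i)) → Prop :=
  fun p e q =>
    ccEvent (fun i => (A i).lbl) e.1 e.2 ∧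
    stepOpt A0.trans p.1 e.1 q.1 ∧
    ∀ i, stepOpt (A i).trans (p.2 i) (e.2 i) (q.2 i)

/-- initial states of the concurrent composition. -/
def ccInit {X0 : Type*} {Xs : Fin L → Type*}
    (A0 : FSA X0 T Λ) (A : ∀ i, FSA (Xs i) T Λ) : Set (X0 × (∀ i, Xs i)) :=
  {p | p.1 ∈ A0.init ∧ ∀ i, p.2 i ∈ (A i).init}

end CC

section Dia

/-- events of the ⋄-variant of the concurrent composition: ε, an event of `T`,
or the fresh event ⋄. -/
inductive DEv (T : Type*) where
  | eps : DEv T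
  | ev : T → DEv T
  | dia : DEv T

variable {X : Type*} {T : Type*} {Λ : Type*} {L : ℕ}

def devOf : Option T → DEv T
  | none => DEv.eps
  | some t => DEv.ev t

def devToOpt : DEv T → Option T
  | DEv.ev t => some t
  | _ => none

/-- transition relation of the variant concurrent composition
`CC_A^⋄(S; S_1, …, S_L)` of an FSA `A` with its local automata given by the
local observation maps `O i`.  A local component equal to `none` is the fresh
state ⋄. -/
def diaTrans (A : FSA X T Λ) (O : Fin L → T → Option Λ) :
    (X × (Fin L → Option X)) → (Option T × (Fin L → DEv T)) →
    (X × (Fin L → Option X)) → Prop :=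
  fun p e q =>
    -- an ordinary transition of the concurrent composition (all components in X)
    ((∃ ts : Fin L → Option T,
        (∀ i, e.2 i = devOf (ts i)) ∧
        ccEvent O e.1 ts ∧
        stepOpt A.trans p.1 e.1 q.1 ∧
        (∀ i, ∃ xi yi, p.2 i = some xi ∧ q.2 i = some yi ∧ stepOpt A.trans xi (ts i) yi)))
    ∨
    -- the extra ⋄-transitions, at states with some component differing from the 0-th
    ((∃ i, p.2 i ≠ some p.1) ∧
     (∀ i, p.2 i ≠ some p.1 → e.2 i = DEv.dia ∧ q.2 i = none) ∧
     (∃ ts : Fin L → Option T,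
        (∀ i, p.2 i = some p.1 → e.2 i = devOf (ts i)) ∧
        ((ccEventOn O (fun i => p.2 i = some p.1) e.1 ts ∧
          stepOpt A.trans p.1 e.1 q.1 ∧
          (∀ i, p.2 i = some p.1 → ∃ yi, q.2 i = some yi ∧ stepOpt A.trans p.1 (ts i) yi))
         ∨
         (e.1 = none ∧ q.1 = p.1 ∧
          (∀ i, p.2 i = some p.1 → ts i = none ∧ q.2 i = some p.1)))))

/-- initial states of the variant concurrent composition. -/
def diaInit (A : FSA X T Λ) : Set (X × (Fin L → Option X)) :=
  {p | p.1 ∈ A.init ∧ ∀ i, ∃ z ∈ A.init, p.2 i = some z}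

end Dia

/-- a (possibly partial) deterministic finite automaton. -/
structure PDFA (Q : Type*) (A : Type*) where
  start : Q
  accept : Set Q
  trans : Set (Q × A × Q)
  deterministic : ∀ q a q' q'', (q, a, q') ∈ trans → (q, a, q'') ∈ trans → q' = q''

namespace PDFA

variable {Q : Type*} {A : Type*}

def step (M : PDFA Q A) (q : Q) (a : A) (q' : Q) : Prop := (q, a, q') ∈ M.trans

def Accepts (M : PDFA Q A) (w : List A) : Prop :=
  ∃ q, RunRel M.step M.start w q ∧ q ∈ M.accept

def Acyclic (M : PDFA Q A) : Prop := ¬ ∃ (q : Q) (w : List A), w ≠ [] ∧ RunRel M.step q w q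

def Complete (M : PDFA Q A) : Prop := ∀ q a, ∃ q', (q, a, q') ∈ M.trans

def Deadlock (M : PDFA Q A) (q : Q) : Prop := ∀ a q', (q, a, q') ∉ M.trans

def DeadlockFree (M : PDFA Q A) : Prop := ∀ q, ∃ a q', (q, a, q') ∈ M.trans

end PDFA

end DES
namespace DES

/-- the three events `a`, `f`, `u` of the reduction. -/
inductive Ev3 where
  | a : Ev3
  | f : Ev3
  | u : Ev3
  deriving DecidableEq

/-- the FSA `S_G = (V ∪ {v_f}, {a, f, u}, {s}, δ_G, {a}, ℓ)` built from a
directed graph `G = (V, E)` and vertices `s, t`; the fresh state `v_f` is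
`Sum.inr ()`, `ℓ(a) = a` (here `some ()`), `ℓ(f) = ℓ(u) = ε`. -/
def graphFSA {V : Type*} (E : Set (V × V)) (s t : V) : FSA (V ⊕ Unit) Ev3 Unit where
  init := {Sum.inl s}
  trans :=
    {tr | (∃ v v', (v, v') ∈ E ∧
              (tr = (Sum.inl v, Ev3.a, Sum.inl v') ∨
               tr = (Sum.inl v, Ev3.a, Sum.inr ()))) ∨
          tr = (Sum.inl t, Ev3.f, Sum.inr ()) ∨
          tr = (Sum.inl t, Ev3.u, Sum.inr ()) ∨
          tr = (Sum.inr (), Ev3.a, Sum.inr ())}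
  lbl := fun e => match e with
    | Ev3.a => some ()
    | _ => none

end DES

namespace DES

lemma gf_fault {V : Type*} (E : Set (V × V)) (s t : V) {p q : V ⊕ Unit} {w : List Ev3}
    (h : RunRel (graphFSA E s t).step p w q) (hf : Ev3.f ∈ w) :
    ∃ x, p = Sum.inl x ∧ Relation.ReflTransGen (fun u v => (u, v) ∈ E) x t := by
  induction h with
  | nil x => simp at hf
  | @cons x y z e w hs hr ih =>
    rcases hs with ⟨v, v', hE, h | h⟩ | h | h | h <;>
      simp only [Prod.mk.injEq] at h <;> obtain ⟨rfl, rfl, rfl⟩ := h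
    · obtain ⟨x, hx, hp⟩ := ih (by simpa using hf)
      obtain rfl := Sum.inl.inj hx
      exact ⟨v, rfl, Relation.ReflTransGen.head hE hp⟩
    · obtain ⟨x, hx, hp⟩ := ih (by simpa using hf)
      cases hx
    · exact ⟨t, rfl, Relation.ReflTransGen.refl⟩
    · exact ⟨t, rfl, Relation.ReflTransGen.refl⟩
    · obtain ⟨x, hx, hp⟩ := ih (by simpa using hf)
      cases hx

lemma gf_loop {V : Type*} (E : Set (V × V)) (s t : V) (k : ℕ) :
    RunRel (graphFSA E s t).step (Sum.inr ()) (List.replicate k Ev3.a) (Sum.inr ()) := by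
  induction k with
  | zero => exact RunRel.nil _
  | succ k ih => exact RunRel.cons (Or.inr (Or.inr (Or.inr rfl))) ih

lemma gf_path {V : Type*} (E : Set (V × V)) (s t : V) {x : V}
    (h : Relation.ReflTransGen (fun u v => (u, v) ∈ E) x t) :
    ∃ n : ℕ, ∀ (w : List Ev3) (z : V ⊕ Unit), RunRel (graphFSA E s t).step (Sum.inl t) w z →
      RunRel (graphFSA E s t).step (Sum.inl x) (List.replicate n Ev3.a ++ w) z := by
  induction h using Relation.ReflTransGen.head_induction_on with
  | refl => exact ⟨0, fun w z h => h⟩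
  | @head a c hE _ ih =>
    obtain ⟨n, hn⟩ := ih
    exact ⟨n + 1, fun w z h =>
      RunRel.cons (Or.inl ⟨a, c, hE, Or.inl rfl⟩) (hn w z h)⟩

end DES

open DES in
/-- `S_G` is not `{f}`-predictable iff there is a directed path from `s` to `t`
in `G` or `s = t`. -/
theorem graphFSA_not_predictable_iff_path
    {V : Type*} [Fintype V] (E : Set (V × V)) (s t : V) :
    ¬ (graphFSA E s t).Predictable {Ev3.f} ↔
    (Relation.TransGen (fun u v => (u, v) ∈ E) s t ∨ s = t) := by
  rw [show (Relation.TransGen (fun u v => (u, v) ∈ E) s t ∨ s = t) ↔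
    Relation.ReflTransGen (fun u v => (u, v) ∈ E) s t by
      rw [Relation.reflTransGen_iff_eq_or_transGen, or_comm, eq_comm]]
  constructor
  · intro h
    by_contra hp
    apply h
    refine ⟨0, ?_⟩
    rintro w ⟨x0, hx0, x, hr⟩ ⟨s₁, e, he, rfl⟩
    exfalso
    obtain rfl : x0 = Sum.inl s := hx0
    obtain rfl : e = Ev3.f := he
    obtain ⟨y, hy, hq⟩ := gf_fault E s t hr (by simp)
    obtain rfl := Sum.inl.inj hy
    exact hp hq
  · rintro hp ⟨k, hk⟩
    obtain ⟨n, hn⟩ := gf_path E s t hp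
    obtain ⟨s', hpre, hnf, H⟩ := hk (List.replicate n Ev3.a ++ [Ev3.f])
      ⟨Sum.inl s, rfl, Sum.inr (), hn _ _ (RunRel.cons (Or.inr (Or.inl rfl)) (RunRel.nil _))⟩
      ⟨_, Ev3.f, rfl, rfl⟩
    have hpre' : s' <+: List.replicate n Ev3.a := by
      rcases List.prefix_concat_iff.1 hpre with h | h
      · exact absurd ⟨Ev3.f, by simp [h], rfl⟩ hnf
      · exact h
    obtain ⟨r, hr⟩ := hpre'
    have hlang : s' ++ (r ++ Ev3.u :: List.replicate k Ev3.a) ∈ (graphFSA E s t).Lang := by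
      refine ⟨Sum.inl s, rfl, Sum.inr (), ?_⟩
      rw [← List.append_assoc, hr]
      exact hn _ _ (RunRel.cons (Or.inr (Or.inr (Or.inl rfl))) (gf_loop E s t k))
    obtain ⟨e, he, hef⟩ := H s' _ hlang rfl hnf (by simp; omega)
    obtain rfl : e = Ev3.f := hef
    have hr2 : Ev3.f ∉ r := by
      intro h
      have : Ev3.f ∈ List.replicate n Ev3.a := by rw [← hr]; simp [h]
      simp at this
    simp [hr2] at he
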